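/- (Local converse theorem for GL_n(ℂ), parameter form.) Let n ∈ ℕ, N, N' : Fin n → ℤ and t, t' : Fin n → ℂ. For K ∈ ℤ and w ∈ ℂ set L(K, w) := 2·(2π)^{−(w + max(−K,0))}·Γ(w + max(−K,0)), where max(−K,0) ∈ ℕ is coerced to ℂ. Assume that for every M ∈ ℤ and every s ∈ ℂ one has ∏_{i : Fin n} L(N i + M, t i + s) = ∏_{i : Fin n} L(N' i + M, t' i + s). Then the multiset {(N i, t i) : i ∈ Fin n} equals the multiset {(N' i, t' i) : i ∈ Fin n} in Multiset (ℤ × ℂ). -/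

import Mathlib

open Complex

/-- The local `L`-factor of the character `χ_{-K, w}` of `ℂ^×`:
`L(χ_{-K,w}) = 2 (2π)^{-(w + max(-K,0))} Γ(w + max(-K,0))`. -/
noncomputable def Lfac (K : ℤ) (w : ℂ) : ℂ :=
  2 * (2 * (Real.pi : ℂ)) ^ (-(w + ((-K).toNat : ℂ))) * Complex.Gamma (w + ((-K).toNat : ℂ))

theorem two_mul_pi_ne_zero : (2 * (Real.pi : ℂ)) ≠ 0 := by
  simp [Real.pi_ne_zero]

theorem Lfac_ne_zero (K : ℤ) {w : ℂ} (hw : 0 < w.re) : Lfac K w ≠ 0 := by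
  have hre : 0 < (w + ((-K).toNat : ℂ)).re := by
    simp only [add_re, natCast_re]
    positivity
  exact mul_ne_zero (mul_ne_zero two_ne_zero (by simp [cpow_eq_zero_iff, Real.pi_ne_zero]))
    (Gamma_ne_zero_of_re_pos hre)

theorem Lfac_sub_one_of_pos {K : ℤ} (hK : 0 < K) (w : ℂ) : Lfac (K - 1) w = Lfac K w := by
  have h1 : (-(K - 1)).toNat = 0 := by omega
  have h2 : (-K).toNat = 0 := by omega
  simp only [Lfac, h1, h2]

theorem Lfac_sub_one_of_nonpos {K : ℤ} (hK : K ≤ 0) {w : ℂ} (hw : 0 < w.re) :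
    Lfac (K - 1) w = (2 * (Real.pi : ℂ))⁻¹ * (w - K) * Lfac K w := by
  have h1 : (-(K - 1)).toNat = (-K).toNat + 1 := by omega
  have h2 : w + ((-K).toNat : ℂ) = w - K := by
    have h : (((-K).toNat : ℤ) : ℂ) = ((-K : ℤ) : ℂ) := by rw [Int.toNat_of_nonneg (by omega)]
    push_cast at h
    rw [h, sub_eq_add_neg]
  have h3 : w - K ≠ 0 := by
    intro h0
    have hre : 0 < (w + ((-K).toNat : ℂ)).re := by
      simp only [add_re, natCast_re]
      positivity
    rw [h2, h0] at hre
    exact lt_irrefl _ hre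
  unfold Lfac
  rw [h1, Nat.cast_add, Nat.cast_one, ← add_assoc, h2, Gamma_add_one _ h3, neg_add,
    cpow_add _ _ two_mul_pi_ne_zero, cpow_neg_one]
  ring

open Polynomial in
/-- The polynomial in `s` by which the product of the `L (N i - k, t i + s)` changes
when `k` is replaced by `k + 1`. -/
noncomputable def shiftPoly {ι : Type*} [Fintype ι] (N : ι → ℤ) (t : ι → ℂ) (k : ℤ) : ℂ[X] :=
  C ((2 * (Real.pi : ℂ))⁻¹ ^ (Finset.univ.filter fun i => N i ≤ k).card) *
    ∏ i with N i ≤ k, (X - C (N i - t i - k))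

theorem roots_shiftPoly {ι : Type*} [Fintype ι] (N : ι → ℤ) (t : ι → ℂ) (k : ℤ) :
    (shiftPoly N t k).roots =
      (Finset.univ.filter fun i => N i ≤ k).val.map fun i => (N i - t i - k : ℂ) := by
  rw [shiftPoly, Polynomial.roots_C_mul _ (pow_ne_zero _ (inv_ne_zero two_mul_pi_ne_zero)),
    Finset.prod_eq_multiset_prod]
  simpa only [Multiset.map_map, Function.comp_def] using
    Polynomial.roots_multiset_prod_X_sub_C
      ((Finset.univ.filter fun i => N i ≤ k).val.map fun i => (N i - t i - k : ℂ))

theorem prod_Lfac_sub_one {ι : Type*} [Fintype ι] (N : ι → ℤ) (t : ι → ℂ) (k : ℤ) {s : ℂ}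
    (hs : ∀ i, 0 < (t i + s).re) :
    ∏ i, Lfac (N i + (-k - 1)) (t i + s) =
      (shiftPoly N t k).eval s * ∏ i, Lfac (N i + -k) (t i + s) := by
  rw [shiftPoly, Polynomial.eval_mul, Polynomial.eval_C, Polynomial.eval_prod,
    ← Finset.prod_const, ← Finset.prod_mul_distrib, Finset.prod_filter, ← Finset.prod_mul_distrib]
  refine Finset.prod_congr rfl fun i _ => ?_
  rw [← add_sub_assoc]
  split_ifs with hi
  · rw [Lfac_sub_one_of_nonpos (by omega) (hs i)]
    simp only [Polynomial.eval_sub, Polynomial.eval_X, Polynomial.eval_C]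
    push_cast
    ring
  · rw [Lfac_sub_one_of_pos (by omega), one_mul]

theorem exists_forall_re_add_natCast_pos {ι : Type*} [Finite ι] (t : ι → ℂ) :
    ∃ m₀ : ℕ, ∀ m ≥ m₀, ∀ i, 0 < (t i + (m : ℂ)).re := by
  rw [← Filter.eventually_atTop, Filter.eventually_all]
  intro i
  filter_upwards [tendsto_natCast_atTop_atTop.eventually_gt_atTop (-(t i).re)] with m hm
  simp only [add_re, natCast_re]
  linarith

theorem shiftPoly_eq_of_prod_Lfac_eq {ι : Type*} [Fintype ι] {N N' : ι → ℤ} {t t' : ι → ℂ}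
    (h : ∀ M : ℤ, ∀ s : ℂ, ∏ i, Lfac (N i + M) (t i + s) = ∏ i, Lfac (N' i + M) (t' i + s))
    (k : ℤ) : shiftPoly N t k = shiftPoly N' t' k := by
  obtain ⟨m, hm⟩ := exists_forall_re_add_natCast_pos t
  obtain ⟨m', hm'⟩ := exists_forall_re_add_natCast_pos t'
  refine Polynomial.eq_of_infinite_eval_eq _ _ (Set.infinite_of_injective_forall_mem
    (f := fun j : ℕ => ((m + m' + j : ℕ) : ℂ)) (fun a b hab => ?_) fun j => ?_)
  · have := Nat.cast_injective (R := ℂ) hab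
    omega
  · have hs := hm (m + m' + j) (by omega)
    have hs' := hm' (m + m' + j) (by omega)
    have key := h (-k - 1) ((m + m' + j : ℕ) : ℂ)
    rw [prod_Lfac_sub_one N t k hs, prod_Lfac_sub_one N' t' k hs', ← h (-k)] at key
    exact mul_right_cancel₀ (Finset.prod_ne_zero_iff.mpr fun i _ => Lfac_ne_zero _ (hs i)) key

theorem count_roots_shiftPoly {ι : Type*} [Fintype ι] (N : ι → ℤ) (t : ι → ℂ) (k : ℤ) (v : ℂ) :
    (shiftPoly N t k).roots.count (v - k) =
      (Finset.univ.filter fun i => N i ≤ k ∧ (N i - t i : ℂ) = v).card := by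
  rw [roots_shiftPoly, Multiset.count_map, ← Finset.filter_val, Finset.card_val,
    Finset.filter_filter]
  simp only [sub_left_inj, eq_comm]

theorem count_map_pair_add_count_roots {ι : Type*} [Fintype ι] (N : ι → ℤ) (t : ι → ℂ) (k : ℤ)
    (w : ℂ) :
    (Finset.univ.val.map fun i => (N i, t i)).count (k, w) +
        (shiftPoly N t (k - 1)).roots.count (k - w - (k - 1 : ℤ)) =
      (shiftPoly N t k).roots.count (k - w - k) := by
  classical
  rw [count_roots_shiftPoly, count_roots_shiftPoly, Multiset.count_map, ← Finset.filter_val,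
    Finset.card_val, ← Finset.card_union_of_disjoint]
  · congr 1
    ext i
    simp only [Finset.mem_union, Finset.mem_filter, Finset.mem_univ, true_and, Prod.mk.injEq]
    constructor
    · rintro (⟨rfl, rfl⟩ | ⟨h1, h2⟩)
      · exact ⟨le_rfl, rfl⟩
      · exact ⟨by omega, h2⟩
    · rintro ⟨h1, h2⟩
      rcases h1.eq_or_lt with rfl | h1
      · exact Or.inl ⟨rfl, (sub_right_injective h2).symm⟩
      · exact Or.inr ⟨by omega, h2⟩
  · rw [Finset.disjoint_filter]
    rintro i - h1 ⟨h2, -⟩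
    have := congrArg Prod.fst h1
    simp only at this
    omega

theorem local_converse_GLn_complex (n : ℕ) (N N' : Fin n → ℤ) (t t' : Fin n → ℂ)
    (h : ∀ M : ℤ, ∀ s : ℂ,
      ∏ i : Fin n, Lfac (N i + M) (t i + s) = ∏ i : Fin n, Lfac (N' i + M) (t' i + s)) :
    Finset.univ.val.map (fun i => (N i, t i)) = Finset.univ.val.map (fun i => (N' i, t' i)) := by
  classical
  ext ⟨k, w⟩
  have e := count_map_pair_add_count_roots N t k w
  rw [shiftPoly_eq_of_prod_Lfac_eq h, shiftPoly_eq_of_prod_Lfac_eq h,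
    ← count_map_pair_add_count_roots N' t' k w] at e
  convert Nat.add_right_cancel e
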